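/- (Measurable Section Theorem) Let (Ω, F, ℙ) be a probability space. For every set S ∈ F ⊗ B(ℝ₊) and every ε > 0 there exists an F-measurable function τ : Ω → [0,∞] such that the graph ⟦τ⟧ is contained in S and ℙ*(π_Ω(S)) − ℙ({τ < ∞}) ≤ ε. -/

import Mathlib

open MeasureTheory Set
open scoped NNReal ENNReal

/-- The graph `⟦τ⟧ ⊆ Ω × ℝ₊` of `τ : Ω → [0,∞]`. -/
def graph {Ω : Type*} (τ : Ω → ℝ≥0∞) : Set (Ω × ℝ≥0) := {p | τ p.1 = (p.2 : ℝ≥0∞)}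

/-- Projection of a subset of `Ω × ℝ₊` onto `Ω`. -/
def projOmega {Ω : Type*} (S : Set (Ω × ℝ≥0)) : Set Ω := Prod.fst '' S

/-- The outer measure `ℙ*` induced by `ℙ`. -/
noncomputable def pstar {Ω : Type*} {F : MeasurableSpace Ω} (P : Measure Ω) (A : Set Ω) :
    ℝ≥0∞ :=
  ⨅ (E : Set Ω) (_ : A ⊆ E) (_ : MeasurableSet E), P E

open Filter Topology

/-- A continuous image of the Baire space is approximated from inside, in outer measure, by the
images of compact sets. -/
theorem exists_isCompact_le_measure_image {X : Type*} [TopologicalSpace X]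
    [TopologicalSpace.MetrizableSpace X] [MeasurableSpace X] [BorelSpace X] (μ : Measure X)
    [IsFiniteMeasure μ] {h : (ℕ → ℕ) → X} (hh : Continuous h) {a : ℝ≥0∞}
    (ha : a < μ (range h)) : ∃ K : Set (ℕ → ℕ), IsCompact K ∧ a ≤ μ (h '' K) := by
  let := TopologicalSpace.metrizableSpaceMetric X
  have step : ∀ (n : ℕ) (C : {C : Set (ℕ → ℕ) // a < μ (h '' C)}),
      ∃ k, a < μ (h '' (C.1 ∩ {x | x n ≤ k})) := by
    rintro n ⟨C, hC⟩
    have hmono : Monotone fun k : ℕ => h '' (C ∩ {x | x n ≤ k}) := fun k l hkl =>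
      image_mono (inter_subset_inter_right _ fun x (hx : x n ≤ k) => hx.trans hkl)
    have hU : h '' C = ⋃ k : ℕ, h '' (C ∩ {x | x n ≤ k}) := by
      rw [← image_iUnion, ← inter_iUnion]
      congr 1
      refine (inter_eq_left.2 fun x _ => mem_iUnion.2 ⟨x n, ?_⟩).symm
      exact le_refl (x n)
    rw [hU, hmono.measure_iUnion] at hC
    exact lt_iSup_iff.1 hC
  choose k hk using step
  let D : ℕ → {C : Set (ℕ → ℕ) // a < μ (h '' C)} := fun n =>
    Nat.rec ⟨univ, by rwa [image_univ]⟩ (fun n C => ⟨C.1 ∩ {x | x n ≤ k n C}, hk n C⟩) n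
  let m : ℕ → ℕ := fun n => k n (D n)
  have hD : ∀ n, (D n).1 = {x | ∀ i < n, x i ≤ m i} := by
    intro n
    induction n with
    | zero => simp [D]
    | succ n ih =>
      change (D n).1 ∩ {x | x n ≤ m n} = _
      rw [ih]
      ext x
      simp only [mem_inter_iff, mem_ofPred_eq, Nat.lt_succ_iff_lt_or_eq, or_imp, forall_and,
        forall_eq]
  have hDanti : Antitone fun n => closure (h '' (D n).1) := by
    refine antitone_nat_of_succ_le fun n => closure_mono (image_mono ?_)
    exact inter_subset_left
  let K : Set (ℕ → ℕ) := Set.pi univ fun i => Iic (m i)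
  have hK : IsCompact K := isCompact_univ_pi fun i => (finite_Iic (m i)).isCompact
  refine ⟨K, hK, ?_⟩
  have hsub : ⋂ n, closure (h '' (D n).1) ⊆ h '' K := by
    intro y hy
    have hx : ∀ n : ℕ, ∃ x ∈ (D n).1, dist y (h x) < 1 / ((n : ℝ) + 1) := fun n => by
      obtain ⟨_, ⟨x, hx, rfl⟩, hd⟩ :=
        Metric.mem_closure_iff.1 (mem_iInter.1 hy n) _ (Nat.one_div_pos_of_nat (α := ℝ) (n := n))
      exact ⟨x, hx, hd⟩
    choose x hxD hxy using hx
    obtain ⟨z, hzK, φ, hφ, hz⟩ := hK.tendsto_subseq (x := fun n => x n ⊓ m)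
      fun n i _ => (inf_le_right : x n i ⊓ m i ≤ m i)
    have hxz : Tendsto (x ∘ φ) atTop (𝓝 z) := by
      rw [tendsto_pi_nhds] at hz ⊢
      intro i
      refine (hz i).congr' ?_
      filter_upwards [eventually_gt_atTop i] with n hn
      have hmem := hxD (φ n)
      rw [hD] at hmem
      exact inf_eq_left.2 (hmem i (hn.trans_le hφ.le_apply))
    have hy' : Tendsto (fun n => h (x n)) atTop (𝓝 y) := by
      rw [tendsto_iff_dist_tendsto_zero]
      refine squeeze_zero (fun _ => dist_nonneg) (fun n => ?_) tendsto_one_div_add_atTop_nhds_zero_nat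
      rw [dist_comm]
      exact (hxy n).le
    exact ⟨z, hzK, tendsto_nhds_unique ((hh.tendsto z).comp hxz) (hy'.comp hφ.tendsto_atTop)⟩
  refine le_trans ?_ (measure_mono hsub)
  rw [hDanti.measure_iInter (fun n => isClosed_closure.measurableSet.nullMeasurableSet)
    ⟨0, measure_ne_top _ _⟩]
  exact le_iInf fun n => (D n).2.le.trans (measure_mono subset_closure)

/-- The lower envelope of a compact subset of `X × ℝ₊` is a measurable section of it. -/
theorem exists_measurable_section_of_isCompact {X : Type*} [TopologicalSpace X] [T2Space X]
    [MeasurableSpace X] [BorelSpace X] {L : Set (X × ℝ≥0)} (hL : IsCompact L) :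
    ∃ τ : X → ℝ≥0∞, Measurable τ ∧ graph τ ⊆ L ∧ {x | τ x < ⊤} = Prod.fst '' L := by
  let τ : X → ℝ≥0∞ := fun x => ⨅ (t : ℝ≥0) (_ : (x, t) ∈ L), (t : ℝ≥0∞)
  have hτle : ∀ {x : X} {t : ℝ≥0}, (x, t) ∈ L → τ x ≤ t := fun {_ t} ht => iInf₂_le t ht
  have hmin : ∀ x, (∃ t, (x, t) ∈ L) → ∃ t : ℝ≥0, (x, t) ∈ L ∧ τ x = t := by
    rintro x ⟨t₀, ht₀⟩
    have hc : IsCompact (Prod.snd '' (L ∩ Prod.fst ⁻¹' {x})) :=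
      (hL.inter_right (isClosed_singleton.preimage continuous_fst)).image continuous_snd
    obtain ⟨t, ⟨⟨⟨x', t'⟩, ⟨hp, hx⟩, hpt⟩, hle⟩⟩ := hc.exists_isLeast ⟨t₀, (x, t₀), ⟨ht₀, rfl⟩, rfl⟩
    obtain rfl : x' = x := hx
    obtain rfl : t' = t := hpt
    refine ⟨t', hp, le_antisymm (hτle hp) (le_iInf₂ fun s hs => ?_)⟩
    exact ENNReal.coe_le_coe.2 (hle ⟨(x', s), ⟨hs, rfl⟩, rfl⟩)
  have hex : ∀ x, τ x < ⊤ → ∃ t, (x, t) ∈ L := fun x hx => by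
    obtain ⟨t, ht⟩ := iInf_lt_iff.1 hx
    obtain ⟨ht, -⟩ := iInf_lt_iff.1 ht
    exact ⟨t, ht⟩
  refine ⟨τ, measurable_of_Iic fun c => ?_, ?_, ?_⟩
  · induction c with
    | top => simp
    | coe c =>
      have : τ ⁻¹' Iic (c : ℝ≥0∞) = Prod.fst '' (L ∩ Prod.snd ⁻¹' Iic c) := by
        ext x
        constructor
        · intro (hx : τ x ≤ c)
          obtain ⟨t, ht, hτ⟩ := hmin x (hex x (hx.trans_lt ENNReal.coe_lt_top))
          exact ⟨(x, t), ⟨ht, ENNReal.coe_le_coe.1 (hτ ▸ hx)⟩, rfl⟩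
        · rintro ⟨⟨x, t⟩, ⟨ht, htc⟩, rfl⟩
          exact (hτle ht).trans (ENNReal.coe_le_coe.2 htc)
      rw [this]
      exact ((hL.inter_right (isClosed_Iic.preimage continuous_snd)).image
        continuous_fst).measurableSet
  · rintro ⟨x, t⟩ (hx : τ x = t)
    obtain ⟨s, hs, hτ⟩ := hmin x (hex x (hx ▸ ENNReal.coe_lt_top))
    obtain rfl : s = t := ENNReal.coe_injective (hτ.symm.trans hx)
    exact hs
  · ext x
    constructor
    · intro hx
      obtain ⟨t, ht⟩ := hex x hx
      exact ⟨(x, t), ht, rfl⟩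
    · rintro ⟨⟨x, t⟩, ht, rfl⟩
      exact (hτle ht).trans_lt ENNReal.coe_lt_top

/-- Approximate measurable section of an analytic set. -/
theorem exists_measurable_section_of_analyticSet {X : Type*} [TopologicalSpace X]
    [TopologicalSpace.MetrizableSpace X] [MeasurableSpace X] [BorelSpace X] (μ : Measure X)
    [IsFiniteMeasure μ] {S : Set (X × ℝ≥0)} (hS : AnalyticSet S) {a : ℝ≥0∞}
    (ha : a < μ (Prod.fst '' S)) :
    ∃ τ : X → ℝ≥0∞, Measurable τ ∧ graph τ ⊆ S ∧ a ≤ μ {x | τ x < ⊤} := by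
  rw [AnalyticSet] at hS
  rcases hS with rfl | ⟨g, hg, rfl⟩
  · simp at ha
  rw [← range_comp] at ha
  obtain ⟨K, hK, haK⟩ := exists_isCompact_le_measure_image μ (continuous_fst.comp hg) ha
  obtain ⟨τ, hτ, hgraph, hfin⟩ := exists_measurable_section_of_isCompact (hK.image hg)
  refine ⟨τ, hτ, hgraph.trans (image_subset_range _ _), ?_⟩
  rwa [hfin, ← image_comp]

/-- A measurable subset of a product depends on the first coordinate only through countably many
measurable sets. -/
theorem MeasurableSet.exists_preimage_prodMap_cantor {Ω β : Type*} [MeasurableSpace Ω]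
    [MeasurableSpace β] {S : Set (Ω × β)} (hS : MeasurableSet S) :
    ∃ (f : Ω → ℕ → Bool) (T : Set ((ℕ → Bool) × β)), Measurable f ∧ MeasurableSet T ∧
      S = Prod.map f id ⁻¹' T := by
  classical
  induction S, hS using MeasurableSpace.induction_on_inter generateFrom_prod.symm isPiSystem_prod with
  | empty => exact ⟨fun _ _ => false, ∅, measurable_const, .empty, rfl⟩
  | basic S hS =>
    obtain ⟨A, hA, B, hB, rfl⟩ := hS
    refine ⟨fun ω _ => decide (ω ∈ A), {x | x 0 = true} ×ˢ B, ?_, ?_, ?_⟩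
    · exact measurable_pi_lambda _ fun _ => measurable_to_bool (by
        convert! hA using 1
        ext; simp)
    · exact (measurableSet_eq_fun (measurable_pi_apply 0) measurable_const).prod hB
    · ext ⟨ω, b⟩
      simp
  | compl S _ ih =>
    obtain ⟨f, T, hf, hT, rfl⟩ := ih
    exact ⟨f, Tᶜ, hf, hT.compl, rfl⟩
  | iUnion S _ _ ih =>
    choose f T hf hT hST using ih
    let p : ℕ → (ℕ → Bool) → ℕ → Bool := fun i x j => x (Nat.pair i j)
    have hp : ∀ i, Measurable (p i) := fun i =>
      measurable_pi_lambda _ fun j => measurable_pi_apply _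
    refine ⟨fun ω n => f n.unpair.1 ω n.unpair.2, ⋃ i, Prod.map (p i) id ⁻¹' T i, ?_, ?_, ?_⟩
    · exact measurable_pi_lambda _ fun n => (measurable_pi_apply _).comp (hf _)
    · exact .iUnion fun i => ((hp i).prodMap measurable_id) (hT i)
    · ext ⟨ω, b⟩
      simp [hST, p]

/-- Measurable Section Theorem: for every `S ∈ F ⊗ B(ℝ₊)` and `ε > 0`
there is an `F`-measurable `τ : Ω → [0,∞]` with graph inside `S` and
`ℙ*(π_Ω(S)) − ℙ({τ < ∞}) ≤ ε`. -/
theorem measurable_section {Ω : Type*} {F : MeasurableSpace Ω}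
    (P : Measure Ω) [IsProbabilityMeasure P]
    (S : Set (Ω × ℝ≥0)) (hS : MeasurableSet S) (ε : ℝ≥0∞) (hε : 0 < ε) :
    ∃ τ : Ω → ℝ≥0∞, Measurable τ ∧ graph τ ⊆ S ∧
      pstar P (projOmega S) - P {ω | τ ω < ⊤} ≤ ε := by
  obtain ⟨f, T, hf, hT, rfl⟩ := hS.exists_preimage_prodMap_cantor
  have hpstar : ∀ A, pstar P A = P A := fun A => (measure_eq_iInf A).symm
  have hproj : projOmega (Prod.map f id ⁻¹' T) ⊆ f ⁻¹' (Prod.fst '' T) := by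
    rintro _ ⟨⟨ω, t⟩, h, rfl⟩
    exact ⟨_, h, rfl⟩
  have := Measure.isProbabilityMeasure_map (μ := P) hf.aemeasurable
  have hle : pstar P (projOmega (Prod.map f id ⁻¹' T)) ≤ P.map f (Prod.fst '' T) := by
    rw [hpstar]
    exact (measure_mono hproj).trans (Measure.le_map_apply hf.aemeasurable _)
  have : PolishSpace Bool := inferInstance
  have : PolishSpace ℝ≥0 := (isClosed_Ici (a := (0 : ℝ))).polishSpace
  rcases eq_or_ne (P.map f (Prod.fst '' T)) 0 with h0 | h0
  · refine ⟨fun _ => ⊤, measurable_const, fun p hp => (ENNReal.top_ne_coe hp).elim, ?_⟩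
    exact tsub_le_self.trans (hle.trans (h0.le.trans hε.le))
  obtain ⟨τ, hτ, hgraph, hfin⟩ := exists_measurable_section_of_analyticSet (P.map f)
    hT.analyticSet (ENNReal.sub_lt_self (measure_ne_top _ _) h0 hε.ne')
  refine ⟨τ ∘ f, hτ.comp hf, fun p hp => hgraph hp, ?_⟩
  rw [Measure.map_apply hf (measurableSet_lt hτ measurable_const)] at hfin
  exact tsub_le_iff_left.2 (hle.trans (tsub_le_iff_right.1 hfin))
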